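/- The linear Chacon map T is quasi-rigid: for every ε > 0 there exist m ∈ ℕ, nonnegative reals α_0, …, α_m with Σ_{i=0}^m α_i > 1 − ε, and a sequence q(k) → ∞ such that for all measurable sets A, B ⊆ X, liminf_{k→∞} μ(T^{q(k)}A ∩ B) ≥ Σ_{i=0}^m α_i μ(T^iA ∩ B). -/

import Mathlib

open MeasureTheory Filter Topology
open scoped symmDiff

/-- A Chacon-type rank-one map (cutting into 3, spacer sequence `s` over the middle
column), acting on a probability space `(X, μ)`. -/
structure ChaconMap {X : Type*} [MeasurableSpace X]
    (μ : Measure X) (s : ℕ → ℕ) : Type _ where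
  /-- The transformation, an invertible bimeasurable map. -/
  T : X ≃ᵐ X
  measurePreserving : MeasurePreserving T μ μ
  /-- The tower heights (number of levels is `h j + 1`). -/
  h : ℕ → ℕ
  h_one : h 1 = 1
  h_succ : ∀ j, 1 ≤ j → h (j + 1) = 3 * h j + 2 + s j
  /-- The base of the `j`-th tower. -/
  E : ℕ → Set X
  E1 : ℕ → Set X
  E2 : ℕ → Set X
  E3 : ℕ → Set X
  measE : ∀ j, MeasurableSet (E j)
  measE1 : ∀ j, MeasurableSet (E1 j)
  measE2 : ∀ j, MeasurableSet (E2 j)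
  measE3 : ∀ j, MeasurableSet (E3 j)
  /-- (i) the levels of the `j`-th tower are pairwise disjoint. -/
  tower_disjoint : ∀ j, 1 ≤ j → ∀ i ≤ h j, ∀ i' ≤ h j, i ≠ i' →
    Disjoint ((⇑T)^[i] '' E j) ((⇑T)^[i'] '' E j)
  /-- (ii) the base is cut into three pieces of equal measure. -/
  E_union : ∀ j, 1 ≤ j → E j = E1 j ∪ E2 j ∪ E3 j
  E_disj12 : ∀ j, 1 ≤ j → Disjoint (E1 j) (E2 j)
  E_disj13 : ∀ j, 1 ≤ j → Disjoint (E1 j) (E3 j)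
  E_disj23 : ∀ j, 1 ≤ j → Disjoint (E2 j) (E3 j)
  E_meas12 : ∀ j, 1 ≤ j → μ (E1 j) = μ (E2 j)
  E_meas23 : ∀ j, 1 ≤ j → μ (E2 j) = μ (E3 j)
  E_next : ∀ j, 1 ≤ j → E (j + 1) = E1 j
  /-- (iii) stacking: the top of the first column is sent to the base of the second. -/
  stack1 : ∀ j, 1 ≤ j → μ (((⇑T)^[h j + 1] '' E1 j) ∆ E2 j) = 0
  /-- (iii) stacking: the top spacer over the second column is sent to the third base. -/
  stack2 : ∀ j, 1 ≤ j → μ (((⇑T)^[h j + 1 + s j] '' E2 j) ∆ E3 j) = 0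
  /-- (iii) the spacer levels are disjoint from the `j`-th tower. -/
  spacer_disjoint : ∀ j, 1 ≤ j → ∀ i, 1 ≤ i → i ≤ s j → ∀ i' ≤ h j,
    Disjoint ((⇑T)^[h j + i] '' E2 j) ((⇑T)^[i'] '' E j)
  /-- (iv) the towers fill up the whole space. -/
  tower_full : Tendsto (fun j => μ (⋃ i ∈ Finset.range (h j + 1), (⇑T)^[i] '' E j))
    atTop (𝓝 1)
  /-- (iv) the levels of the towers generate the full σ-algebra mod `μ`. -/
  generates : ∀ A : Set X, MeasurableSet A → ∃ B : Set X,
    MeasurableSet[MeasurableSpace.generateFrom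
      {S : Set X | ∃ j, 1 ≤ j ∧ ∃ i ≤ h j, S = (⇑T)^[i] '' E j}] B ∧ μ (A ∆ B) = 0


set_option linter.unusedSectionVars false

namespace ChaconAux

section
variable {X : Type*} [MeasurableSpace X] {μ : Measure X} (C : ChaconMap μ (fun j => j))

/-- Image of `S` under the integer power `T ^ z`, written as a preimage. -/
def im (z : ℤ) (S : Set X) : Set X := ⇑((C.T.toEquiv : Equiv.Perm X) ^ (-z)) ⁻¹' S

lemma mp_zpow (z : ℤ) :
    MeasurePreserving (⇑((C.T.toEquiv : Equiv.Perm X) ^ z)) μ μ := by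
  have hnat : ∀ n : ℕ, MeasurePreserving (⇑((C.T.toEquiv : Equiv.Perm X) ^ n)) μ μ := by
    intro n
    rw [Equiv.Perm.coe_pow]
    exact C.measurePreserving.iterate n
  have hinv : MeasurePreserving (⇑((C.T.toEquiv : Equiv.Perm X)⁻¹)) μ μ :=
    C.measurePreserving.symm C.T
  have hnat2 : ∀ n : ℕ, MeasurePreserving (⇑((C.T.toEquiv : Equiv.Perm X)⁻¹ ^ n)) μ μ := by
    intro n
    rw [Equiv.Perm.coe_pow]
    exact hinv.iterate n
  rcases Int.eq_nat_or_neg z with ⟨n, rfl | rfl⟩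
  · rw [zpow_natCast]; exact hnat n
  · rw [zpow_neg, zpow_natCast, ← inv_pow]; exact hnat2 n

lemma im_zero (S : Set X) : im C 0 S = S := by simp [im]

lemma im_im (a b : ℤ) (S : Set X) : im C a (im C b S) = im C (a + b) S := by
  unfold im
  rw [← Set.preimage_comp, ← Equiv.Perm.coe_mul, ← zpow_add, neg_add_rev]

lemma im_nat (n : ℕ) (S : Set X) : im C (n : ℤ) S = (⇑C.T)^[n] '' S := by
  unfold im
  rw [zpow_neg, zpow_natCast]
  have : (⇑C.T)^[n] = ⇑((C.T.toEquiv : Equiv.Perm X) ^ n) := by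
    rw [Equiv.Perm.coe_pow]; rfl
  rw [this, Equiv.image_eq_preimage_symm]
  rfl

lemma im_meas (z : ℤ) {S : Set X} (hS : MeasurableSet S) : MeasurableSet (im C z S) :=
  (mp_zpow C _).measurable hS

lemma im_real (z : ℤ) {S : Set X} (hS : MeasurableSet S) : μ.real (im C z S) = μ.real S :=
  (mp_zpow C _).measureReal_preimage hS.nullMeasurableSet

lemma im_ae (z : ℤ) {S R : Set X} (h : S =ᵐ[μ] R) : im C z S =ᵐ[μ] im C z R :=
  (mp_zpow C _).quasiMeasurePreserving.preimage_ae_eq h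

lemma im_le (z : ℤ) {S R : Set X} (h : S ≤ᵐ[μ] R) : im C z S ≤ᵐ[μ] im C z R :=
  (mp_zpow C _).quasiMeasurePreserving.preimage_mono_ae h

lemma im_inter (z : ℤ) (S R : Set X) : im C z (S ∩ R) = im C z S ∩ im C z R := rfl
lemma im_union (z : ℤ) (S R : Set X) : im C z (S ∪ R) = im C z S ∪ im C z R := rfl
lemma im_symmDiff (z : ℤ) (S R : Set X) : im C z (S ∆ R) = im C z S ∆ im C z R := rfl
lemma im_mono (z : ℤ) {S R : Set X} (h : S ⊆ R) : im C z S ⊆ im C z R :=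
  Set.preimage_mono h
lemma im_disj (z : ℤ) {S R : Set X} (h : Disjoint S R) : Disjoint (im C z S) (im C z R) :=
  h.preimage _
lemma im_biUnion (z : ℤ) (I : Finset ℕ) (f : ℕ → Set X) :
    im C z (⋃ i ∈ I, f i) = ⋃ i ∈ I, im C z (f i) := by
  simp [im]

/-- correlation -/
noncomputable def c (z : ℤ) (A B : Set X) : ℝ := μ.real (im C z A ∩ B)

lemma c_shift (z a b : ℤ) {A B : Set X} (hA : MeasurableSet A) (hB : MeasurableSet B) :
    c C z (im C a A) (im C b B) = c C (z + a - b) A B := by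
  unfold c
  rw [im_im]
  have : im C (z + a) A ∩ im C b B = im C b (im C (z + a - b) A ∩ B) := by
    rw [im_inter, im_im]; congr 2; ring
  rw [this, im_real _ _ ((im_meas C _ hA).inter hB)]

lemma c_swap (z : ℤ) {A B : Set X} (hA : MeasurableSet A) (hB : MeasurableSet B) :
    c C (-z) A B = c C z B A := by
  have := c_shift C z (-z) 0 hB (hA)
  unfold c
  have h2 : im C z B ∩ A = im C z (B ∩ im C (-z) A) := by
    rw [im_inter, im_im]; simp [im_zero]
  rw [h2, im_real _ _ (hB.inter (im_meas C _ hA)), Set.inter_comm]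

lemma c_nonneg (z : ℤ) (A B : Set X) : 0 ≤ c C z A B := measureReal_nonneg

variable [IsProbabilityMeasure μ]

lemma c_approx (z : ℤ) {A B A' B' : Set X} (hA : MeasurableSet A) (hB : MeasurableSet B)
    (hA' : MeasurableSet A') (hB' : MeasurableSet B') :
    |c C z A B - c C z A' B'| ≤ μ.real (A ∆ A') + μ.real (B ∆ B') := by
  unfold c
  have h1 := abs_measureReal_sub_le_measureReal_symmDiff (μ := μ)
    ((im_meas C z hA).inter hB).nullMeasurableSet ((im_meas C z hA').inter hB').nullMeasurableSet
  refine h1.trans ?_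
  have h2 : (im C z A ∩ B) ∆ (im C z A' ∩ B') ⊆ im C z (A ∆ A') ∪ (B ∆ B') := by
    rw [im_symmDiff]
    intro x
    simp only [Set.mem_symmDiff, Set.mem_inter_iff, Set.mem_union]
    tauto
  refine (measureReal_mono h2).trans ((measureReal_union_le _ _).trans ?_)
  rw [im_real C z (hA.symmDiff hA')]

/-! ### the tower -/
lemma st1 (j : ℕ) (hj : 1 ≤ j) : im C ((C.h j : ℤ) + 1) (C.E1 j) =ᵐ[μ] C.E2 j := by
  have := C.stack1 j hj
  rw [← im_nat] at this
  exact_mod_cast measure_symmDiff_eq_zero_iff.1 this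

lemma st2 (j : ℕ) (hj : 1 ≤ j) : im C ((C.h j : ℤ) + 1 + j) (C.E2 j) =ᵐ[μ] C.E3 j := by
  have := C.stack2 j hj
  rw [← im_nat] at this
  exact_mod_cast measure_symmDiff_eq_zero_iff.1 this

lemma E1_sub (j : ℕ) (hj : 1 ≤ j) : C.E1 j ⊆ C.E j := by
  rw [C.E_union j hj]; intro x hx; simp [hx]
lemma E2_sub (j : ℕ) (hj : 1 ≤ j) : C.E2 j ⊆ C.E j := by
  rw [C.E_union j hj]; intro x hx; simp [hx]
lemma E3_sub (j : ℕ) (hj : 1 ≤ j) : C.E3 j ⊆ C.E j := by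
  rw [C.E_union j hj]; intro x hx; simp [hx]

lemma E_anti (j v : ℕ) (hj : 1 ≤ j) : C.E (j + v) ⊆ C.E j := by
  induction v with
  | zero => simp
  | succ v ih =>
    rw [← add_assoc, C.E_next _ (by omega)]
    exact (E1_sub C _ (by omega)).trans ih

lemma E_parts (j : ℕ) (hj : 1 ≤ j) : μ.real (C.E1 j) = μ.real (C.E j) / 3 ∧
    μ.real (C.E2 j) = μ.real (C.E j) / 3 ∧ μ.real (C.E3 j) = μ.real (C.E j) / 3 := by
  have h : μ.real (C.E j) = μ.real (C.E1 j) + μ.real (C.E2 j) + μ.real (C.E3 j) := by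
    rw [C.E_union j hj, measureReal_union _ (C.measE3 j), measureReal_union _ (C.measE2 j)]
    · exact C.E_disj12 j hj
    · exact Disjoint.union_left (C.E_disj13 j hj) (C.E_disj23 j hj)
  have h1 : μ.real (C.E1 j) = μ.real (C.E2 j) := by simp [Measure.real, C.E_meas12 j hj]
  have h2 : μ.real (C.E2 j) = μ.real (C.E3 j) := by simp [Measure.real, C.E_meas23 j hj]
  refine ⟨?_, ?_, ?_⟩ <;> linarith

lemma E_meas (j v : ℕ) (hj : 1 ≤ j) : μ.real (C.E (j + v)) = (1/3) ^ v * μ.real (C.E j) := by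
  induction v with
  | zero => simp
  | succ v ih =>
    rw [← add_assoc, C.E_next _ (by omega), (E_parts C _ (by omega)).1, ih, pow_succ]
    ring

lemma top_sub (j v : ℕ) (hj : 1 ≤ j) :
    im C ((C.h (j + v) : ℤ) - C.h j) (C.E (j + v)) ≤ᵐ[μ] C.E j := by
  induction v with
  | zero => simp only [add_zero, sub_self, im_zero]; exact EventuallyLE.refl _ _
  | succ v ih =>
    refine EventuallyLE.trans ?_ ih
    have hk : 1 ≤ j + v := by omega
    have e1 : (C.h (j + (v + 1)) : ℤ) - C.h j =
        ((C.h (j + v) : ℤ) - C.h j) + (((C.h (j + v) : ℤ) + 1 + (j + v : ℕ)) +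
          ((C.h (j + v) : ℤ) + 1)) := by
      rw [← add_assoc, C.h_succ _ hk]; push_cast; ring
    rw [e1, ← im_im, ← im_im, ← add_assoc, C.E_next _ hk]
    apply im_le
    refine (EventuallyEq.le ?_).trans (LE.le.eventuallyLE (E3_sub C _ hk))
    exact (im_ae C _ (st1 C _ hk)).trans (st2 C _ hk)

lemma real_mono_ae {S R : Set X} (h : S ≤ᵐ[μ] R) : μ.real S ≤ μ.real R :=
  ENNReal.toReal_mono (measure_ne_top _ _) (measure_mono_ae h)

/-- first return estimate -/
lemma base1 (j M : ℕ) (hj : 1 ≤ j) :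
    (∑ v ∈ Finset.range M, (1/3 : ℝ) ^ (v + 1)) * μ.real (C.E j) ≤
      c C ((C.h j : ℤ) + 1) (C.E j) (C.E j) := by
  have hdis : ∀ v w, v < w → Disjoint (C.E2 (j + v)) (C.E2 (j + w)) := by
    intro v w hvw
    have h1 : C.E2 (j + w) ⊆ C.E1 (j + v) := by
      rw [← C.E_next _ (by omega)]
      obtain ⟨k, rfl⟩ := Nat.exists_eq_add_of_lt hvw
      refine (E2_sub C _ (by omega)).trans ?_
      have := E_anti C (j + v + 1) k (by omega)
      have e : j + (v + k + 1) = j + v + 1 + k := by omega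
      rw [e]; exact this
    exact ((C.E_disj12 _ (by omega)).mono_left h1).symm
  have hs : μ.real (⋃ v ∈ Finset.range M, C.E2 (j + v)) =
      (∑ v ∈ Finset.range M, (1/3 : ℝ) ^ (v + 1)) * μ.real (C.E j) := by
    rw [measureReal_biUnion_finset, Finset.sum_mul]
    · refine Finset.sum_congr rfl fun v _ => ?_
      rw [(E_parts C _ (by omega)).2.1, E_meas C j v hj, pow_succ]
      ring
    · intro v _ w _ hvw
      rcases lt_or_gt_of_ne hvw with h | h
      · exact hdis v w h
      · exact (hdis w v h).symm
    · exact fun v _ => C.measE2 _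
  rw [← hs]
  apply real_mono_ae
  have : ∀ v, C.E2 (j + v) ≤ᵐ[μ] (im C ((C.h j : ℤ) + 1) (C.E j) ∩ C.E j : Set X) := by
    intro v
    have hk : 1 ≤ j + v := by omega
    have h1 : C.E2 (j + v) ≤ᵐ[μ] im C ((C.h j : ℤ) + 1) (C.E j) := by
      refine (st1 C _ hk).symm.le.trans ?_
      have : (C.h (j + v) : ℤ) + 1 = ((C.h j : ℤ) + 1) + ((C.h (j + v) : ℤ) - C.h j) := by ring
      rw [this, ← im_im]
      apply im_le
      exact (LE.le.eventuallyLE (im_mono C _ (E1_sub C _ hk))).trans (top_sub C j v hj)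
    have h2 : C.E2 (j + v) ≤ᵐ[μ] C.E j :=
      LE.le.eventuallyLE ((E2_sub C _ hk).trans (E_anti C j v hj))
    filter_upwards [h1, h2] with x hx1 hx2 hx
    exact ⟨hx1 hx, hx2 hx⟩
  have h3 := EventuallyLE.biUnion (l := ae μ) (Finset.range M).finite_toSet
    (f := fun v => C.E2 (j + v)) (g := fun _ => im C ((C.h j : ℤ) + 1) (C.E j) ∩ C.E j)
    (fun v _ => this v)
  refine EventuallyLE.trans (by simpa using h3) (LE.le.eventuallyLE ?_)
  intro x hx
  simp only [Set.mem_iUnion] at hx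
  obtain ⟨_, _, h⟩ := hx
  exact h

lemma base2 (j v : ℕ) (hj : 1 ≤ j) :
    (1/3 : ℝ) ^ (v + 1) * μ.real (C.E j) ≤
      c C ((C.h j : ℤ) + 1 + (j + v : ℕ)) (C.E j) (C.E j) := by
  have hk : 1 ≤ j + v := by omega
  have : (1/3 : ℝ) ^ (v + 1) * μ.real (C.E j) = μ.real (C.E3 (j + v)) := by
    rw [(E_parts C _ hk).2.2, E_meas C j v hj, pow_succ]; ring
  rw [this]
  apply real_mono_ae
  have h1 : C.E3 (j + v) ≤ᵐ[μ] im C ((C.h j : ℤ) + 1 + (j + v : ℕ)) (C.E j) := by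
    refine (st2 C _ hk).symm.le.trans ?_
    have : (C.h (j + v) : ℤ) + 1 + (j + v : ℕ) =
      ((C.h j : ℤ) + 1 + (j + v : ℕ)) + ((C.h (j + v) : ℤ) - C.h j) := by ring
    rw [this, ← im_im]
    apply im_le
    exact (LE.le.eventuallyLE (im_mono C _ (E2_sub C _ hk))).trans (top_sub C j v hj)
  have h2 : C.E3 (j + v) ≤ᵐ[μ] C.E j :=
    LE.le.eventuallyLE ((E3_sub C _ hk).trans (E_anti C j v hj))
  filter_upwards [h1, h2] with x hx1 hx2 hx
  exact ⟨hx1 hx, hx2 hx⟩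

lemma lev_disj (j : ℕ) (hj : 1 ≤ j) (i i' : ℕ) (hi : i ≤ C.h j) (hi' : i' ≤ C.h j)
    (hne : i ≠ i') : Disjoint (im C (i : ℤ) (C.E j)) (im C (i' : ℤ) (C.E j)) := by
  rw [im_nat, im_nat]; exact C.tower_disjoint j hj i hi i' hi' hne

/-- correlations of a level with itself at nonzero small times vanish -/
lemma c_lev (j : ℕ) (hj : 1 ≤ j) (i i' : ℕ) (hi : i ≤ C.h j) (hi' : i' ≤ C.h j) :
    c C ((i : ℤ) - i') (C.E j) (C.E j) = if i = i' then μ.real (C.E j) else 0 := by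
  have h := c_shift C 0 i i' (C.measE j) (C.measE j)
  rw [zero_add] at h
  rw [← h]
  split_ifs with h1
  · subst h1
    rw [c, im_zero, Set.inter_self, im_real C _ (C.measE j)]
  · rw [c, im_zero, (lev_disj C j hj i i' hi hi' h1).inter_eq]; simp

lemma lev_est (j M a b : ℕ) (hj : 1 ≤ j) (ha : a ≤ C.h j) (hb : b ≤ C.h j) (ha' : j + M ≤ a) :
    ∑ v ∈ Finset.range M, (1/3 : ℝ) ^ (v + 1) *
      (c C 0 (im C a (C.E j)) (im C b (C.E j)) +
        c C (-((j + v : ℕ) : ℤ)) (im C a (C.E j)) (im C b (C.E j))) ≤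
      c C ((C.h j : ℤ) + 1) (im C a (C.E j)) (im C b (C.E j)) := by
  have hE := C.measE j
  have e2 : ∀ v ∈ Finset.range M, c C (-((j + v : ℕ) : ℤ)) (im C a (C.E j)) (im C b (C.E j)) =
      if a - (j + v) = b then μ.real (C.E j) else 0 := by
    intro v hv
    rw [Finset.mem_range] at hv
    rw [c_shift C _ _ _ hE hE, ← c_lev C j hj (a - (j + v)) b (by omega) hb]
    congr 1
    omega
  rw [Finset.sum_congr rfl (fun v hv => by rw [e2 v hv])]
  simp_rw [c_shift C _ _ _ hE hE, zero_add]
  rw [c_lev C j hj a b ha hb]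
  by_cases hab : a = b
  · subst hab
    have := base1 C j M hj
    rw [Finset.sum_mul] at this
    simp only [if_true, add_sub_cancel_right]
    refine le_trans (le_of_eq ?_) this
    refine Finset.sum_congr rfl fun v hv => ?_
    rw [Finset.mem_range] at hv
    rw [if_neg (by omega)]; ring
  · simp only [if_neg hab, zero_add]
    by_cases hv : ∃ v ∈ Finset.range M, a - (j + v) = b
    · obtain ⟨v, hv, hvb⟩ := hv
      rw [Finset.sum_eq_single_of_mem v hv]
      · rw [if_pos hvb]
        refine (base2 C j v hj).trans (le_of_eq ?_)
        rw [Finset.mem_range] at hv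
        congr 1
        omega
      · intro w hw hwv
        rw [Finset.mem_range] at hv hw
        rw [if_neg (by omega), mul_zero]
    · push Not at hv
      rw [Finset.sum_eq_zero]
      · exact c_nonneg C _ _ _
      · intro v hv'
        rw [if_neg (hv v hv'), mul_zero]


/-- union of levels -/
def lu (j : ℕ) (I : Finset ℕ) : Set X := ⋃ i ∈ I, im C (i : ℤ) (C.E j)

lemma lu_meas (j : ℕ) (I : Finset ℕ) : MeasurableSet (lu C j I) :=
  Finset.measurableSet_biUnion _ fun _ _ => im_meas C _ (C.measE j)

lemma c_lu (j : ℕ) (hj : 1 ≤ j) (I J : Finset ℕ) (hI : ∀ i ∈ I, i ≤ C.h j)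
    (hJ : ∀ i ∈ J, i ≤ C.h j) (z : ℤ) :
    c C z (lu C j I) (lu C j J) =
      ∑ a ∈ I, ∑ b ∈ J, c C z (im C a (C.E j)) (im C b (C.E j)) := by
  unfold c lu
  have hE : ∀ z, MeasurableSet (im C z (C.E j)) := fun z => im_meas C z (C.measE j)
  have e : (im C z (⋃ i ∈ I, im C (i : ℤ) (C.E j)) ∩ ⋃ i ∈ J, im C (i : ℤ) (C.E j)) =
      ⋃ a ∈ I, ⋃ b ∈ J, (im C z (im C (a : ℤ) (C.E j)) ∩ im C (b : ℤ) (C.E j)) := by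
    rw [im_biUnion]
    ext x
    simp only [Set.mem_inter_iff, Set.mem_iUnion, exists_prop]
    constructor
    · rintro ⟨⟨a, ha, h1⟩, b, hb, h2⟩; exact ⟨a, ha, b, hb, h1, h2⟩
    · rintro ⟨a, ha, b, hb, h1, h2⟩; exact ⟨⟨a, ha, h1⟩, b, hb, h2⟩
  rw [e, measureReal_biUnion_finset (h := fun _ _ => measure_ne_top _ _)]
  · refine Finset.sum_congr rfl fun a _ => ?_
    rw [measureReal_biUnion_finset]
    · intro b hb b' hb' hne
      exact (lev_disj C j hj b b' (hJ b hb) (hJ b' hb') hne).mono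
        Set.inter_subset_right Set.inter_subset_right
    · exact fun b _ => (im_meas C _ (hE _)).inter (hE _)
  · intro a ha a' ha' hne
    refine (im_disj C z (lev_disj C j hj a a' (hI a ha) (hI a' ha') hne)).mono ?_ ?_
    · exact Set.iUnion₂_subset fun _ _ => Set.inter_subset_left
    · exact Set.iUnion₂_subset fun _ _ => Set.inter_subset_left
  · exact fun a _ => Finset.measurableSet_biUnion _ fun b _ =>
      (im_meas C _ (hE _)).inter (hE _)

lemma lu_est (j M : ℕ) (hj : 1 ≤ j) (I J : Finset ℕ) (hI : ∀ i ∈ I, i ≤ C.h j)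
    (hI' : ∀ i ∈ I, j + M ≤ i) (hJ : ∀ i ∈ J, i ≤ C.h j) :
    ∑ v ∈ Finset.range M, (1/3 : ℝ) ^ (v + 1) *
      (c C 0 (lu C j I) (lu C j J) + c C (-((j + v : ℕ) : ℤ)) (lu C j I) (lu C j J)) ≤
      c C ((C.h j : ℤ) + 1) (lu C j I) (lu C j J) := by
  simp_rw [c_lu C j hj I J hI hJ, ← Finset.sum_add_distrib, Finset.mul_sum]
  rw [Finset.sum_comm]
  refine Finset.sum_le_sum fun a ha => ?_
  rw [Finset.sum_comm]
  refine Finset.sum_le_sum fun b hb => ?_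
  exact lev_est C j M a b hj (hI a ha) (hJ b hb) (hI' a ha)

/-! ### approximation -/

lemma lu_union (j : ℕ) (I J : Finset ℕ) : lu C j (I ∪ J) = lu C j I ∪ lu C j J := by
  unfold lu; exact Finset.set_biUnion_union _ _ _

lemma lu_single (j i : ℕ) : lu C j {i} = im C (i : ℤ) (C.E j) := by
  simp [lu]

lemma refine1 (j i : ℕ) (hj : 1 ≤ j) (hi : i ≤ C.h j) :
    ∃ J : Finset ℕ, (∀ a ∈ J, a ≤ C.h (j + 1)) ∧
      im C (i : ℤ) (C.E j) =ᵐ[μ] lu C (j + 1) J := by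
  have hs := C.h_succ j hj
  refine ⟨{i} ∪ {i + (C.h j + 1)} ∪ {i + (C.h j + 1 + j) + (C.h j + 1)}, ?_, ?_⟩
  · intro a ha
    simp only [Finset.mem_union, Finset.mem_singleton] at ha
    omega
  · rw [lu_union, lu_union, lu_single, lu_single, lu_single, C.E_next j hj]
    rw [C.E_union j hj, im_union, im_union]
    have h1 : im C ((i + (C.h j + 1) : ℕ) : ℤ) (C.E1 j) =ᵐ[μ] im C (i : ℤ) (C.E2 j) := by
      push_cast
      rw [← im_im]
      exact im_ae C _ (st1 C j hj)
    have h2 : im C ((i + (C.h j + 1 + j) + (C.h j + 1) : ℕ) : ℤ) (C.E1 j) =ᵐ[μ]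
        im C (i : ℤ) (C.E3 j) := by
      push_cast
      rw [← im_im, ← im_im]
      exact im_ae C _ ((im_ae C _ (st1 C j hj)).trans (st2 C j hj))
    exact (((EventuallyEq.refl _ _).union h1).union h2).symm

lemma refine2 (j : ℕ) (hj : 1 ≤ j) (I : Finset ℕ) (hI : ∀ i ∈ I, i ≤ C.h j) :
    ∃ J : Finset ℕ, (∀ a ∈ J, a ≤ C.h (j + 1)) ∧ lu C j I =ᵐ[μ] lu C (j + 1) J := by
  classical
  induction I using Finset.induction_on with
  | empty => exact ⟨∅, by simp, by simp [lu]⟩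
  | insert i I hi ih =>
    obtain ⟨J, hJ, hJ'⟩ := ih (fun a ha => hI a (Finset.mem_insert_of_mem ha))
    obtain ⟨K, hK, hK'⟩ := refine1 C j i hj (hI i (Finset.mem_insert_self _ _))
    refine ⟨K ∪ J, ?_, ?_⟩
    · intro a ha
      rcases Finset.mem_union.1 ha with h | h
      · exact hK a h
      · exact hJ a h
    · rw [Finset.insert_eq, lu_union, lu_union, lu_single]
      exact hK'.union hJ'

lemma refine3 (j v : ℕ) (hj : 1 ≤ j) (i : ℕ) (hi : i ≤ C.h j) :
    ∃ J : Finset ℕ, (∀ a ∈ J, a ≤ C.h (j + v)) ∧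
      im C (i : ℤ) (C.E j) =ᵐ[μ] lu C (j + v) J := by
  induction v with
  | zero => exact ⟨{i}, by simpa using hi, by rw [lu_single]; rfl⟩
  | succ v ih =>
    obtain ⟨J, hJ, hJ'⟩ := ih
    obtain ⟨K, hK, hK'⟩ := refine2 C (j + v) (by omega) J hJ
    exact ⟨K, hK, hJ'.trans hK'⟩

/-- approximable sets -/
def Apx (A : Set X) : Prop := ∀ δ : ℝ, 0 < δ → ∀ᶠ j in atTop,
  ∃ I : Finset ℕ, (∀ i ∈ I, i ≤ C.h j) ∧ μ.real (A ∆ lu C j I) ≤ δ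

lemma symm_tri (A B D : Set X) : μ.real (A ∆ D) ≤ μ.real (A ∆ B) + μ.real (B ∆ D) :=
  measureReal_symmDiff_le (μ := μ) (s := A) (t := B) D (measure_ne_top _ _) (measure_ne_top _ _)

lemma apx_ae {A B : Set X} (h : μ (A ∆ B) = 0) (hB : Apx C B) : Apx C A := by
  intro δ hδ
  filter_upwards [hB δ hδ] with j hj
  obtain ⟨I, hI, hI'⟩ := hj
  refine ⟨I, hI, (symm_tri A B _).trans ?_⟩
  have : μ.real (A ∆ B) = 0 := by simp [Measure.real, h]
  linarith

lemma apx_level (j i : ℕ) (hj : 1 ≤ j) (hi : i ≤ C.h j) : Apx C (im C (i : ℤ) (C.E j)) := by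
  intro δ hδ
  filter_upwards [eventually_ge_atTop j] with k hk
  obtain ⟨v, rfl⟩ := Nat.exists_eq_add_of_le hk
  obtain ⟨J, hJ, hJ'⟩ := refine3 C j v hj i hi
  refine ⟨J, hJ, ?_⟩
  have := measure_symmDiff_eq_zero_iff.2 hJ'
  simp [Measure.real, this, hδ.le]

lemma apx_union {A B : Set X} (hA : Apx C A) (hB : Apx C B) : Apx C (A ∪ B) := by
  intro δ hδ
  filter_upwards [hA (δ / 2) (by linarith), hB (δ / 2) (by linarith)] with j h1 h2
  obtain ⟨I, hI, hI'⟩ := h1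
  obtain ⟨J, hJ, hJ'⟩ := h2
  refine ⟨I ∪ J, ?_, ?_⟩
  · intro a ha
    rcases Finset.mem_union.1 ha with h | h
    · exact hI a h
    · exact hJ a h
  · rw [lu_union]
    have : (A ∪ B) ∆ (lu C j I ∪ lu C j J) ⊆ (A ∆ lu C j I) ∪ (B ∆ lu C j J) := by
      intro x
      simp only [Set.mem_symmDiff, Set.mem_union]
      tauto
    have h3 := (measureReal_mono (μ := μ) this).trans (measureReal_union_le _ _)
    linarith

lemma apx_compl {A : Set X} (hA : Apx C A) : Apx C Aᶜ := by
  intro δ hδ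
  have hfull : Tendsto (fun j => μ.real (lu C j (Finset.range (C.h j + 1)))) atTop (𝓝 1) := by
    have := (ENNReal.tendsto_toReal ENNReal.one_ne_top).comp C.tower_full
    refine this.congr fun j => ?_
    simp only [Function.comp, Measure.real, lu, im_nat]
  have h2 := hfull.eventually (eventually_gt_nhds (show (1 - δ / 2 : ℝ) < 1 by linarith))
  filter_upwards [hA (δ / 2) (by linarith), h2, eventually_ge_atTop 1] with j h1 h2 hj
  obtain ⟨I, hI, hI'⟩ := h1
  refine ⟨Finset.range (C.h j + 1) \ I, ?_, ?_⟩
  · intro a ha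
    simp only [Finset.mem_sdiff, Finset.mem_range] at ha
    omega
  · set F := lu C j (Finset.range (C.h j + 1)) with hF
    have hm : MeasurableSet F := lu_meas C _ _
    have hFc : μ.real Fᶜ ≤ δ / 2 := by
      rw [probReal_compl_eq_one_sub hm]; linarith
    have hsub : Aᶜ ∆ lu C j (Finset.range (C.h j + 1) \ I) ⊆ (A ∆ lu C j I) ∪ Fᶜ := by
      have k1 : ∀ x, x ∈ F → x ∉ lu C j I → x ∈ lu C j (Finset.range (C.h j + 1) \ I) := by
        intro x hx hxI
        simp only [hF, lu, Set.mem_iUnion, exists_prop, Finset.mem_sdiff] at hx hxI ⊢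
        obtain ⟨i, hi, hxi⟩ := hx
        exact ⟨i, ⟨hi, fun h => hxI ⟨i, h, hxi⟩⟩, hxi⟩
      have k2 : ∀ x, x ∈ lu C j (Finset.range (C.h j + 1) \ I) → x ∉ lu C j I := by
        intro x hx hxI
        simp only [lu, Set.mem_iUnion, exists_prop, Finset.mem_sdiff, Finset.mem_range] at hx hxI
        obtain ⟨i, ⟨hi, hi2⟩, hxi⟩ := hx
        obtain ⟨i', hi', hxi'⟩ := hxI
        have hne : i ≠ i' := by rintro rfl; exact hi2 hi'
        exact Set.disjoint_left.1 (lev_disj C j hj i i' (by omega) (hI i' hi') hne) hxi hxi'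
      intro x
      have := k1 x
      have := k2 x
      simp only [Set.mem_symmDiff, Set.mem_union, Set.mem_compl_iff]
      tauto
    have h3 := (measureReal_mono (μ := μ) hsub).trans (measureReal_union_le _ _)
    linarith

lemma apx_empty : Apx C (∅ : Set X) := by
  intro δ hδ
  exact Eventually.of_forall fun j => ⟨∅, by simp, by simp [lu, hδ.le]⟩

lemma apx_iUnion {f : ℕ → Set X} (hm : ∀ n, MeasurableSet (f n)) (hf : ∀ n, Apx C (f n)) :
    Apx C (⋃ n, f n) := by
  have hacc : ∀ n, Apx C (Set.accumulate f n) := by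
    intro n
    induction n with
    | zero => simpa using hf 0
    | succ n ih => rw [Set.accumulate_succ]; exact apx_union C ih (hf _)
  have hmacc : ∀ n, MeasurableSet (Set.accumulate f n) := fun n =>
    MeasurableSet.biUnion (Set.to_countable _) fun m _ => hm m
  intro δ hδ
  have ht : Tendsto (fun n => μ.real (Set.accumulate f n)) atTop (𝓝 (μ.real (⋃ n, f n))) :=
    (ENNReal.tendsto_toReal (measure_ne_top _ _)).comp tendsto_measure_iUnion_accumulate
  obtain ⟨n, hn⟩ := (ht.eventually (eventually_gt_nhds
    (show μ.real (⋃ n, f n) - δ / 2 < μ.real (⋃ n, f n) by linarith))).exists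
  filter_upwards [hacc n (δ / 2) (by linarith)] with j hj
  obtain ⟨I, hI, hI'⟩ := hj
  refine ⟨I, hI, (symm_tri _ (Set.accumulate f n) _).trans ?_⟩
  have hsub : Set.accumulate f n ⊆ ⋃ n, f n := Set.accumulate_subset_iUnion n
  have : μ.real ((⋃ n, f n) ∆ Set.accumulate f n) ≤ δ / 2 := by
    rw [symmDiff_of_ge hsub, measureReal_sdiff hsub (hmacc n)]
    linarith
  linarith

lemma apx_all {A : Set X} (hA : MeasurableSet A) : Apx C A := by
  obtain ⟨B, hB, hAB⟩ := C.generates A hA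
  refine apx_ae C hAB ?_
  have hle : MeasurableSpace.generateFrom
      {S : Set X | ∃ j, 1 ≤ j ∧ ∃ i ≤ C.h j, S = (⇑C.T)^[i] '' C.E j} ≤ ‹MeasurableSpace X› := by
    apply MeasurableSpace.generateFrom_le
    rintro S ⟨j, hj, i, hi, rfl⟩
    rw [← im_nat]; exact im_meas C _ (C.measE j)
  refine MeasurableSpace.generateFrom_induction _ (fun S _ => Apx C S) ?_ ?_ ?_ ?_ B hB
  · rintro S ⟨j, hj, i, hi, rfl⟩ _
    rw [← im_nat]; exact apx_level C j i hj hi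
  · exact apx_empty C
  · intro t _ h; exact apx_compl C h
  · intro s hs h; exact apx_iUnion C (fun n => hle _ (hs n)) h

/-- approximation avoiding the lowest `j + M` levels -/
lemma apx_high (M : ℕ) {A : Set X} (hA : MeasurableSet A) (δ : ℝ) (hδ : 0 < δ) :
    ∀ᶠ j in atTop, ∃ I : Finset ℕ, (∀ i ∈ I, i ≤ C.h j) ∧ (∀ i ∈ I, j + M ≤ i) ∧
      μ.real (A ∆ lu C j I) ≤ δ := by
  have hlim : Tendsto (fun j : ℕ => ((j : ℝ) + M) * (3 * (1/3 : ℝ) ^ j)) atTop (𝓝 0) := by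
    have h1 := tendsto_self_mul_const_pow_of_lt_one (r := (1/3 : ℝ)) (by norm_num) (by norm_num)
    have h2 := tendsto_pow_atTop_nhds_zero_of_lt_one (r := (1/3 : ℝ)) (by norm_num) (by norm_num)
    have := (h1.const_mul 3).add (h2.const_mul (3 * (M : ℝ)))
    simp only [mul_zero, add_zero] at this
    refine this.congr fun j => ?_
    ring
  filter_upwards [apx_all C hA (δ / 2) (by linarith), eventually_ge_atTop 1,
    hlim.eventually (eventually_lt_nhds (show (0 : ℝ) < δ / 2 by linarith))] with j h1 hj hs
  obtain ⟨I, hI, hI'⟩ := h1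
  refine ⟨I.filter (fun i => j + M ≤ i), ?_, ?_, ?_⟩
  · intro i hi; exact hI i (Finset.mem_filter.1 hi).1
  · intro i hi; exact (Finset.mem_filter.1 hi).2
  · have hsub : A ∆ lu C j (I.filter (fun i => j + M ≤ i)) ⊆
        (A ∆ lu C j I) ∪ lu C j (Finset.range (j + M)) := by
      have k1 : ∀ x, x ∈ lu C j I → x ∉ lu C j (Finset.range (j + M)) →
          x ∈ lu C j (I.filter (fun i => j + M ≤ i)) := by
        intro x hx hx2
        simp only [lu, Set.mem_iUnion, exists_prop, Finset.mem_filter, Finset.mem_range] at *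
        obtain ⟨i, hi, hxi⟩ := hx
        exact ⟨i, ⟨hi, not_lt.1 fun h => hx2 ⟨i, h, hxi⟩⟩, hxi⟩
      have k2 : ∀ x, x ∈ lu C j (I.filter (fun i => j + M ≤ i)) → x ∈ lu C j I := by
        intro x hx
        simp only [lu, Set.mem_iUnion, exists_prop, Finset.mem_filter] at *
        obtain ⟨i, hi, hxi⟩ := hx
        exact ⟨i, hi.1, hxi⟩
      intro x
      have := k1 x
      have := k2 x
      simp only [Set.mem_symmDiff, Set.mem_union]
      tauto
    have h3 := (measureReal_mono (μ := μ) hsub).trans (measureReal_union_le _ _)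
    have h4 : μ.real (lu C j (Finset.range (j + M))) ≤ ((j : ℝ) + M) * (3 * (1/3 : ℝ) ^ j) := by
      refine (measureReal_biUnion_finset_le _ _).trans ?_
      have hEj : μ.real (C.E j) ≤ 3 * (1/3 : ℝ) ^ j := by
        obtain ⟨k, rfl⟩ := Nat.exists_eq_add_of_le hj
        rw [E_meas C 1 k le_rfl, pow_add]
        have := measureReal_le_one (μ := μ) (s := C.E 1)
        have h0 : (0 : ℝ) ≤ (1/3) ^ k := by positivity
        nlinarith
      simp only [im_real C _ (C.measE j), Finset.sum_const, Finset.card_range, nsmul_eq_mul]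
      push_cast
      gcongr
    linarith

lemma geo_le_one (M : ℕ) : ∑ v ∈ Finset.range M, (1/3 : ℝ) ^ (v + 1) ≤ 1 / 2 := by
  have : ∀ M, ∑ v ∈ Finset.range M, (1/3 : ℝ) ^ (v + 1) = 1/2 - 1/2 * (1/3) ^ M := by
    intro M
    induction M with
    | zero => simp
    | succ M ih => rw [Finset.sum_range_succ, ih]; ring
  rw [this]
  have : (0 : ℝ) ≤ (1/3) ^ M := by positivity
  linarith

/-- key estimate -/
lemma key (M : ℕ) {A B : Set X} (hA : MeasurableSet A) (hB : MeasurableSet B)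
    (δ : ℝ) (hδ : 0 < δ) : ∀ᶠ j : ℕ in atTop,
    ∑ v ∈ Finset.range M, (1/3 : ℝ) ^ (v + 1) *
      (c C 0 A B + c C (-((j + v : ℕ) : ℤ)) A B) - δ ≤ c C ((C.h j : ℤ) + 1) A B := by
  filter_upwards [apx_high C M hA (δ / 4) (by linarith), apx_high C M hB (δ / 4) (by linarith),
    eventually_ge_atTop 1] with j h1 h2 hj
  obtain ⟨I, hI, hI', hIA⟩ := h1
  obtain ⟨J, hJ, -, hJB⟩ := h2
  have hc : ∀ z, |c C z A B - c C z (lu C j I) (lu C j J)| ≤ δ / 2 := by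
    intro z
    have := c_approx C z hA hB (lu_meas C j I) (lu_meas C j J)
    linarith
  have hest := lu_est C j M hj I J hI hI' hJ
  have h3 := (abs_le.1 (hc ((C.h j : ℤ) + 1))).1
  have h4 : ∑ v ∈ Finset.range M, (1/3 : ℝ) ^ (v + 1) *
      (c C 0 A B + c C (-((j + v : ℕ) : ℤ)) A B) ≤
      ∑ v ∈ Finset.range M, ((1/3 : ℝ) ^ (v + 1) *
      (c C 0 (lu C j I) (lu C j J) + c C (-((j + v : ℕ) : ℤ)) (lu C j I) (lu C j J)) +
        (1/3 : ℝ) ^ (v + 1) * δ) := by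
    refine Finset.sum_le_sum fun v _ => ?_
    rw [← mul_add]
    have a1 := (abs_le.1 (hc 0)).2
    have a2 := (abs_le.1 (hc (-((j + v : ℕ) : ℤ)))).2
    refine mul_le_mul_of_nonneg_left ?_ (by positivity)
    linarith
  rw [Finset.sum_add_distrib, ← Finset.sum_mul] at h4
  have h5 := mul_le_mul_of_nonneg_right (geo_le_one M) hδ.le
  linarith

lemma h_ge (j : ℕ) (hj : 1 ≤ j) : j ≤ C.h j := by
  induction j, hj using Nat.le_induction with
  | base => rw [C.h_one]
  | succ j hj ih => have := C.h_succ j hj; omega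

/-- the sequence -/
def qs (r : ℕ) (l : ℕ) : ℕ := (fun j => C.h j + 1)^[r] l

lemma qs_tendsto (r : ℕ) : Tendsto (qs C r) atTop atTop := by
  have h1 : Tendsto (fun j => C.h j + 1) atTop atTop := by
    refine tendsto_atTop_mono' atTop ?_ tendsto_id
    filter_upwards [eventually_ge_atTop 1] with j hj
    have := h_ge C j hj
    simp only [id]; omega
  induction r with
  | zero => exact tendsto_id
  | succ r ih =>
    have : qs C (r + 1) = (fun j => C.h j + 1) ∘ qs C r := by
      funext l; simp only [qs, Function.iterate_succ_apply', Function.comp]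
    rw [this]; exact h1.comp ih

lemma main_ind (r : ℕ) : ∀ ε : ℝ, 0 < ε → ∃ (ι : Type) (_ : Fintype ι) (a : ι → ℝ) (d : ι → ℤ),
    (∀ i, 0 ≤ a i) ∧ 1 - (1/2 : ℝ) ^ r - ε < ∑ i, a i ∧
    ∀ A B : Set X, MeasurableSet A → MeasurableSet B → ∀ δ : ℝ, 0 < δ →
      ∀ᶠ l in atTop, ∑ i, a i * c C (d i) A B - δ ≤ c C (qs C r l : ℤ) A B := by
  induction r with
  | zero =>
    intro ε hε
    refine ⟨Empty, inferInstance, fun _ => 0, fun _ => 0, by simp, by simp [hε], ?_⟩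
    intro A B _ _ δ hδ
    refine Eventually.of_forall fun l => ?_
    have := c_nonneg C (qs C 0 l : ℤ) A B
    simp only [Finset.univ_eq_empty, Finset.sum_empty]
    linarith
  | succ r ih =>
    intro ε hε
    obtain ⟨ι, hι, a, d, ha, hW, H⟩ := ih ε hε
    set W := ∑ i, a i with hWdef
    have hlim : Tendsto (fun M : ℕ => (1/2 - 1/2 * (1/3 : ℝ) ^ M) * (1 + W)) atTop
        (𝓝 ((1/2 - 1/2 * 0) * (1 + W))) :=
      (((tendsto_pow_atTop_nhds_zero_of_lt_one (by norm_num) (by norm_num)).const_mul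
        (1/2 : ℝ)).const_sub (1/2 : ℝ)).mul_const _
    have hlt : 1 - (1/2 : ℝ) ^ (r + 1) - ε < (1/2 - 1/2 * 0) * (1 + W) := by
      rw [pow_succ]; linarith
    obtain ⟨M, hM⟩ := (hlim.eventually (eventually_gt_nhds hlt)).exists
    have hgeo : ∀ M, ∑ v ∈ Finset.range M, (1/3 : ℝ) ^ (v + 1) = 1/2 - 1/2 * (1/3) ^ M := by
      intro M
      induction M with
      | zero => simp
      | succ M ih => rw [Finset.sum_range_succ, ih]; ring
    refine ⟨Fin M ⊕ (Fin M × ι), inferInstance,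
      Sum.elim (fun v => (1/3 : ℝ) ^ ((v : ℕ) + 1))
        (fun p => (1/3 : ℝ) ^ ((p.1 : ℕ) + 1) * a p.2),
      Sum.elim (fun _ => 0) (fun p => -(d p.2) - (p.1 : ℕ)), ?_, ?_, ?_⟩
    · rintro (v | p)
      · simp only [Sum.elim_inl]; positivity
      · simp only [Sum.elim_inr]; exact mul_nonneg (by positivity) (ha _)
    · refine hM.trans_le (le_of_eq ?_)
      simp only [Fintype.sum_sum_type, Fintype.sum_prod_type, Sum.elim_inl, Sum.elim_inr,
        ← Finset.mul_sum, ← Finset.sum_mul]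
      rw [← hWdef, Fin.sum_univ_eq_sum_range (fun v => (1/3 : ℝ) ^ (v + 1)), hgeo]
      ring
    · intro A B hA hB δ hδ
      have hk := (qs_tendsto C r).eventually (key C M hA hB (δ / 2) (by linarith))
      have hv : ∀ᶠ l in atTop, ∀ v : Fin M,
          ∑ i, a i * c C (d i) B (im C (-((v : ℕ) : ℤ)) A) - δ ≤
            c C (qs C r l : ℤ) B (im C (-((v : ℕ) : ℤ)) A) :=
        eventually_all.2 fun v => H B _ hB (im_meas C _ hA) δ hδ
      filter_upwards [hk, hv] with l hl1 hl2
      have eq1 : (qs C (r + 1) l : ℤ) = (C.h (qs C r l) : ℤ) + 1 := by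
        simp only [qs, Function.iterate_succ_apply']; push_cast; rfl
      rw [eq1]
      refine le_trans ?_ hl1
      have sh : ∀ (z : ℤ) (v : ℕ), c C z B (im C (-(v : ℤ)) A) = c C (-z - v) A B := by
        intro z v
        have := c_shift C z 0 (-(v : ℤ)) hB hA
        rw [im_zero] at this
        rw [this, ← c_swap C _ hA hB]
        congr 1; ring
      simp only [sh] at hl2
      simp only [Fintype.sum_sum_type, Fintype.sum_prod_type, Sum.elim_inl, Sum.elim_inr]
      rw [← Fin.sum_univ_eq_sum_range (fun v => (1/3 : ℝ) ^ (v + 1) *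
        (c C 0 A B + c C (-((qs C r l + v : ℕ) : ℤ)) A B))]
      have hsum : ∑ v : Fin M, ((1/3 : ℝ) ^ ((v : ℕ) + 1) * c C 0 A B +
          (∑ i, (1/3 : ℝ) ^ ((v : ℕ) + 1) * a i * c C (-(d i) - (v : ℕ)) A B)) ≤
          ∑ v : Fin M, ((1/3 : ℝ) ^ ((v : ℕ) + 1) *
        (c C 0 A B + c C (-((qs C r l + v : ℕ) : ℤ)) A B) + (1/3 : ℝ) ^ ((v : ℕ) + 1) * δ) := by
        refine Finset.sum_le_sum fun v _ => ?_
        have := hl2 v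
        have e : -((qs C r l + v : ℕ) : ℤ) = -(qs C r l : ℤ) - (v : ℕ) := by push_cast; ring
        rw [e]
        simp only [mul_assoc, ← Finset.mul_sum]
        rw [← mul_add, ← mul_add]
        refine mul_le_mul_of_nonneg_left ?_ (by positivity)
        linarith
      rw [Finset.sum_add_distrib, Finset.sum_add_distrib, ← Finset.sum_mul _ _ δ,
        Fin.sum_univ_eq_sum_range (fun v => (1/3 : ℝ) ^ (v + 1))] at hsum
      have h5 := mul_le_mul_of_nonneg_right (geo_le_one M) hδ.le
      linarith

end
end ChaconAux

/-- the linear Chacon map (`s j = j`) is quasi-rigid. -/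
theorem linearChacon_quasiRigid
    {X : Type*} [MeasurableSpace X] (μ : Measure X) [IsProbabilityMeasure μ]
    (C : ChaconMap μ (fun j => j)) :
    ∀ ε : ℝ, 0 < ε →
      ∃ (m : ℕ) (α : Fin (m + 1) → ℝ), (∀ i, 0 ≤ α i) ∧ (∑ i, α i) > 1 - ε ∧
        ∃ q : ℕ → ℕ, Tendsto q atTop atTop ∧
          ∀ A B : Set X, MeasurableSet A → MeasurableSet B →
            (∑ i, α i * (μ ((⇑C.T)^[(i : ℕ)] '' A ∩ B)).toReal)
              ≤ liminf (fun k => (μ ((⇑C.T)^[q k] '' A ∩ B)).toReal) atTop := by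
  intro ε hε
  obtain ⟨r, hr⟩ := exists_pow_lt_of_lt_one (show (0 : ℝ) < ε / 2 by linarith)
    (show (1/2 : ℝ) < 1 by norm_num)
  obtain ⟨ι, hι, a, d, ha, hW, H⟩ := ChaconAux.main_ind C r (ε / 2) (by linarith)
  classical
  set D : ℕ := ∑ i, (d i).natAbs with hD
  have hd : ∀ i, (d i).natAbs ≤ D := fun i =>
    Finset.single_le_sum (f := fun i => (d i).natAbs) (fun _ _ => Nat.zero_le _)
      (Finset.mem_univ i)
  have hd0 : ∀ i, 0 ≤ d i + D := fun i => by have := hd i; omega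
  have hlt : ∀ i, (d i + D).toNat < 2 * D + 1 := fun i => by have := hd i; omega
  let g : ι → Fin (2 * D + 1) := fun i => ⟨(d i + D).toNat, hlt i⟩
  have hg : ∀ i, ((g i : ℕ) : ℤ) = d i + D := fun i => by
    simp only [g]; exact Int.toNat_of_nonneg (hd0 i)
  refine ⟨2 * D, fun k => ∑ i ∈ Finset.univ.filter (fun i => g i = k), a i, ?_, ?_,
    fun l => ChaconAux.qs C r l + D, ?_, ?_⟩
  · exact fun k => Finset.sum_nonneg fun i _ => ha i
  · rw [Finset.sum_fiberwise]
    linarith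
  · exact tendsto_atTop_mono (fun l => Nat.le_add_right _ _) (ChaconAux.qs_tendsto C r)
  · intro A B hA hB
    have hc : ∀ n : ℕ, (μ ((⇑C.T)^[n] '' A ∩ B)).toReal = ChaconAux.c C (n : ℤ) A B := by
      intro n
      rw [ChaconAux.c, ChaconAux.im_nat]; rfl
    simp only [hc]
    have hsum : ∑ k : Fin (2 * D + 1), (∑ i ∈ Finset.univ.filter (fun i => g i = k), a i) *
        ChaconAux.c C ((k : ℕ) : ℤ) A B = ∑ i, a i * ChaconAux.c C (d i + D) A B := by
      rw [← Finset.sum_fiberwise Finset.univ g]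
      refine Finset.sum_congr rfl fun k _ => ?_
      rw [Finset.sum_mul]
      refine Finset.sum_congr rfl fun i hi => ?_
      rw [← (Finset.mem_filter.1 hi).2, hg]
    rw [hsum]
    have hsh : ∀ z : ℤ, ChaconAux.c C z (ChaconAux.im C D A) B =
        ChaconAux.c C (z + D) A B := by
      intro z
      have := ChaconAux.c_shift C z D 0 hA hB
      rw [ChaconAux.im_zero] at this
      rw [this, sub_zero]
    have hH := H (ChaconAux.im C D A) B (ChaconAux.im_meas C _ hA) hB
    simp only [hsh] at hH
    refine le_of_forall_pos_sub_le fun δ hδ => ?_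
    refine le_liminf_of_le ?_ ?_
    · refine IsBoundedUnder.isCoboundedUnder_ge ⟨1, ?_⟩
      rw [eventually_map]
      exact Eventually.of_forall fun l => measureReal_le_one
    · filter_upwards [hH δ hδ] with l hl
      push_cast
      exact hl
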